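/- Assume the matrix Ξ is positive-definite and let α_min > 0 denote its smallest eigenvalue. Then for every u ∈ C_c^∞(Ω), ∫_Ω (A∇u)·∇u dx ≥ (α_min/2) |u|_𝒱². -/

import Mathlib

open MeasureTheory

/-- Partial derivative in the `i`-th coordinate direction. -/
noncomputable def pd {d : ℕ} (f : (Fin d → ℝ) → ℝ) (i : Fin d) (x : Fin d → ℝ) : ℝ :=
  fderiv ℝ f x (Pi.single i 1)

/-- The open unit cube `Ω = (0,1)^d`. -/
def cube (d : ℕ) : Set (Fin d → ℝ) := Set.univ.pi fun _ => Set.Ioo (0 : ℝ) 1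

/-- The diffusion matrix `A_{ij}(x) = (ρ_{ij} σ_i σ_j / 2) x_i x_j (1-x_i)(1-x_j)`. -/
noncomputable def Amat {d : ℕ} (σ : Fin d → ℝ) (ρ : Fin d → Fin d → ℝ)
    (i j : Fin d) (x : Fin d → ℝ) : ℝ :=
  ρ i j * σ i * σ j / 2 * (x i * x j * (1 - x i) * (1 - x j))

/-- `ã_i(x) = r + σ_i² x_i - σ_i² + (σ_i/2) ∑_{j≠i} ρ_{ij} σ_j (2x_j - 1)`. -/
noncomputable def atilde {d : ℕ} (σ : Fin d → ℝ) (ρ : Fin d → Fin d → ℝ) (r : ℝ)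
    (i : Fin d) (x : Fin d → ℝ) : ℝ :=
  r + σ i ^ 2 * x i - σ i ^ 2 +
    σ i / 2 * ∑ j ∈ Finset.univ.erase i, ρ i j * σ j * (2 * x j - 1)

/-- The drift vector field `a_i(x) = x_i (1-x_i) ã_i(x)`. -/
noncomputable def avec {d : ℕ} (σ : Fin d → ℝ) (ρ : Fin d → Fin d → ℝ) (r : ℝ)
    (i : Fin d) (x : Fin d → ℝ) : ℝ :=
  x i * (1 - x i) * atilde σ ρ r i x

/-- The square of the seminorm `|v|_𝒱² = ∑_i ∫_Ω |x_i (1-x_i) ∂v/∂x_i|²`. -/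
noncomputable def Vsemisq {d : ℕ} (v : (Fin d → ℝ) → ℝ) : ℝ :=
  ∑ i, ∫ x in cube d, (x i * (1 - x i) * pd v i x) ^ 2

/-- The norm `‖v‖_𝒱 = (‖v‖²_{L²(Ω)} + |v|_𝒱²)^{1/2}`. -/
noncomputable def Vnorm {d : ℕ} (v : (Fin d → ℝ) → ℝ) : ℝ :=
  Real.sqrt ((∫ x in cube d, (v x) ^ 2) + Vsemisq v)

/-- The bilinear form `b̃(v,w) = ∫_Ω (A∇v)·∇w - ∫_Ω (a·∇v) w + r ∫_Ω v w`. -/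
noncomputable def btilde {d : ℕ} (σ : Fin d → ℝ) (ρ : Fin d → Fin d → ℝ) (r : ℝ)
    (v w : (Fin d → ℝ) → ℝ) : ℝ :=
  (∫ x in cube d, ∑ i, (∑ j, Amat σ ρ i j x * pd v j x) * pd w i x)
    - (∫ x in cube d, (∑ i, avec σ ρ r i x * pd v i x) * w x)
    + r * ∫ x in cube d, v x * w x

/-- `v ∈ C_c^∞(Ω)`: smooth, compactly supported, with support inside `Ω = (0,1)^d`. -/
def IsTestFun {d : ℕ} (v : (Fin d → ℝ) → ℝ) : Prop :=
  ContDiff ℝ (⊤ : ℕ∞) v ∧ HasCompactSupport v ∧ tsupport v ⊆ cube d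

lemma rayleigh_aux {d : ℕ} (M : Matrix (Fin d) (Fin d) ℝ) (hM : M.IsHermitian) (a : ℝ)
    (ha : ∀ i, a ≤ hM.eigenvalues i) (y : Fin d → ℝ) :
    a * ∑ i, y i ^ 2 ≤ ∑ i, (∑ j, M i j * y j) * y i := by
  let b := hM.eigenvectorBasis
  let Y : EuclideanSpace ℝ (Fin d) := WithLp.toLp 2 y
  let Z : EuclideanSpace ℝ (Fin d) := WithLp.toLp 2 (M.mulVec y)
  have h1 : ∑ i, y i ^ 2 = ∑ k, inner ℝ Y (b k) * inner ℝ (b k) Y := by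
    rw [b.sum_inner_mul_inner]
    rw [PiLp.inner_apply]
    simp [Y, pow_two]
  have h2 : ∑ i, (∑ j, M i j * y j) * y i = ∑ k, inner ℝ Y (b k) * inner ℝ (b k) Z := by
    rw [b.sum_inner_mul_inner]
    simp [Y, Z, PiLp.inner_apply, Matrix.mulVec, dotProduct]
  have h3 : ∀ k, inner ℝ (b k) Z = hM.eigenvalues k * inner ℝ (b k) Y := by
    intro k
    have e1 : inner ℝ (b k) Z = (b k).ofLp ⬝ᵥ M.mulVec y := by
      simp [Z, PiLp.inner_apply, dotProduct, mul_comm]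
    have e2 : inner ℝ (b k) Y = (b k).ofLp ⬝ᵥ y := by
      simp [Y, PiLp.inner_apply, dotProduct, mul_comm]
    have hT : M.transpose = M := by
      have := hM.eq
      rwa [Matrix.conjTranspose_eq_transpose_of_trivial] at this
    rw [e1, e2, Matrix.dotProduct_mulVec, ← Matrix.mulVec_transpose, hT,
      hM.mulVec_eigenvectorBasis, smul_dotProduct, smul_eq_mul]
  rw [h1, h2, Finset.mul_sum]
  refine Finset.sum_le_sum fun k _ => ?_
  rw [h3, real_inner_comm Y (b k)]
  nlinarith [mul_le_mul_of_nonneg_right (ha k) (mul_self_nonneg (inner ℝ Y (b k)))]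

lemma integrable_cube_aux {d : ℕ} {f : (Fin d → ℝ) → ℝ} (hf : Continuous f) :
    IntegrableOn f (cube d) := by
  refine (hf.continuousOn.integrableOn_compact (isCompact_Icc (a := 0) (b := 1))).mono_set ?_
  intro x hx
  exact ⟨fun i => (hx i trivial).1.le, fun i => (hx i trivial).2.le⟩

/-- Coercivity of the diffusion part: if `Ξ_{ij} = ρ_{ij} σ_i σ_j` is positive-definite with
smallest eigenvalue `α_min`, then for every `u ∈ C_c^∞(Ω)`,
`∫_Ω (A∇u)·∇u ≥ (α_min / 2) |u|_𝒱²`. -/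
theorem diffusion_coercive
    {d : ℕ} (hd : 1 ≤ d) (σ : Fin d → ℝ) (hσ : ∀ i, 0 < σ i)
    (ρ : Fin d → Fin d → ℝ) (hρsymm : ∀ i j, ρ i j = ρ j i) (hρdiag : ∀ i, ρ i i = 1)
    (hΞ : (Matrix.of fun i j : Fin d => ρ i j * σ i * σ j).PosDef)
    (αmin : ℝ) (hαmin : αmin = ⨅ i, hΞ.1.eigenvalues i) (hαpos : 0 < αmin) :
    ∀ u : (Fin d → ℝ) → ℝ, IsTestFun u →
      ∫ x in cube d, ∑ i, (∑ j, Amat σ ρ i j x * pd u j x) * pd u i x ≥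
        αmin / 2 * Vsemisq u := by
  intro u hu
  have hpd : ∀ i, Continuous (pd u i) := fun i =>
    (hu.1.continuous_fderiv (by simp)).clm_apply continuous_const
  have hA : ∀ i j, Continuous (Amat σ ρ i j) := fun i j => by
    unfold Amat; fun_prop
  have hα : ∀ i, αmin ≤ hΞ.1.eigenvalues i := fun i => by
    rw [hαmin]; exact ciInf_le (Set.finite_range _).bddBelow i
  unfold Vsemisq
  rw [← integral_finsetSum _ (fun i _ => integrable_cube_aux (by fun_prop)),
    ← integral_const_mul]
  refine integral_mono (integrable_cube_aux (by fun_prop)) (integrable_cube_aux (by fun_prop)) ?_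
  intro x
  have h := rayleigh_aux _ hΞ.1 αmin hα (fun i => x i * (1 - x i) * pd u i x)
  have e : ∑ i, (∑ j, Amat σ ρ i j x * pd u j x) * pd u i x
      = 1 / 2 * ∑ i, (∑ j, (Matrix.of fun i j : Fin d => ρ i j * σ i * σ j) i j *
        (x j * (1 - x j) * pd u j x)) * (x i * (1 - x i) * pd u i x) := by
    simp only [Finset.mul_sum, Finset.sum_mul, Amat, Matrix.of_apply]
    refine Finset.sum_congr rfl fun i _ => Finset.sum_congr rfl fun j _ => ?_
    ring
  simp only
  rw [e]
  linarith
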